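/- arXiv:2605.12463 — 2 statements merged into one kernel-verified Lean document; each statement's English description precedes it below -/
import Mathlib

section
/- Let h : ℝ → ℝ be convex on [1, ∞) and differentiable on [1, ∞), and let r_max ≥ 1 be such that the derivative h' is constant on [r_max, ∞) (h is linear at infinity). Then for all r, r' with 1 ≤ r ≤ r' one has h'(r') − h'(r) ≤ A_h(r') − A_h(r) ≤ r_max·(h'(r') − h'(r)), where A_h(s) = s·h'(s) − h(s). -/
/-- A convex function lies above its tangent lines. -/
theorem ConvexOn.deriv_mul_sub_le {S : Set ℝ} {f : ℝ → ℝ} (hf : ConvexOn ℝ S f) {x y : ℝ}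
    (hx : x ∈ S) (hy : y ∈ S) (hfx : DifferentiableAt ℝ f x) :
    deriv f x * (y - x) ≤ f y - f x := by
  rcases lt_trichotomy x y with hxy | rfl | hxy
  · have := hf.deriv_le_slope hx hy hxy hfx
    rwa [slope_def_field, le_div_iff₀ (sub_pos.2 hxy)] at this
  · simp
  · have := hf.slope_le_deriv hy hx hxy hfx
    rw [slope_def_field, div_le_iff₀ (sub_pos.2 hxy)] at this
    linarith

/-- Bi-Lipschitz property of the action function. For `h` convex and
differentiable on `[1, ∞)`, linear at infinity (derivative constant on `[r_max, ∞)`,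
`r_max ≥ 1`), and `1 ≤ r ≤ r'`, one has
`h'(r') − h'(r) ≤ A_h(r') − A_h(r) ≤ r_max·(h'(r') − h'(r))` where
`A_h(s) = s·h'(s) − h(s)`. -/
theorem action_function_bilipschitz
    (h : ℝ → ℝ) (rmax : ℝ)
    (hconv : ConvexOn ℝ (Set.Ici (1 : ℝ)) h)
    (hdiff : ∀ r ∈ Set.Ici (1 : ℝ), DifferentiableAt ℝ h r)
    (hrmax : 1 ≤ rmax)
    (hlin : ∀ r ∈ Set.Ici rmax, deriv h r = deriv h rmax)
    (r r' : ℝ) (hr : 1 ≤ r) (hrr' : r ≤ r') :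
    deriv h r' - deriv h r ≤ (r' * deriv h r' - h r') - (r * deriv h r - h r) ∧
      (r' * deriv h r' - h r') - (r * deriv h r - h r) ≤
        rmax * (deriv h r' - deriv h r) := by
  have tangent : ∀ x y : ℝ, 1 ≤ x → 1 ≤ y → deriv h x * (y - x) ≤ h y - h x :=
    fun x y hx hy ↦ hconv.deriv_mul_sub_le hx hy (hdiff x hx)
  have hr' : 1 ≤ r' := hr.trans hrr'
  have hmono : deriv h r ≤ deriv h r' := by
    rcases hrr'.eq_or_lt with rfl | hlt
    · rfl
    · nlinarith [tangent r r' hr hr', tangent r' r hr' hr]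
  constructor
  · nlinarith [tangent r' r hr' hr, mul_nonneg (sub_nonneg.2 hr) (sub_nonneg.2 hmono)]
  · rcases le_total r' rmax with hle | hle
    · nlinarith [tangent r r' hr hr', mul_nonneg (sub_nonneg.2 hle) (sub_nonneg.2 hmono)]
    · have ht' := hlin r' hle
      rcases le_total rmax r with hle' | hle'
      · have ht := hlin r hle'
        have := tangent r r' hr hr'
        rw [ht] at this
        rw [ht, ht']
        linarith
      · have h₁ := tangent rmax r' hrmax hr'
        have h₂ := tangent r rmax hr hrmax
        rw [ht']
        linarith
end

section
/- Let h : ℝ → ℝ be convex and differentiable on [1, ∞), with h(1) = 0, h(x) ≥ 0 for all x ∈ [1, ∞), and h'(r) > 0 for every r > 1. Fix t > 0, and suppose that for every s > 0 a point r_s ∈ [1, ∞) is given satisfying s·h'(r_s) = t. Then t·r_s − s·h(r_s) converges to t as s → ∞. -/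
/-- For `h` convex and differentiable on `[1, ∞)` with `h(1) = 0`,
`h ≥ 0` on `[1, ∞)`, and `h' > 0` on `(1, ∞)`, fix `t > 0`; if for each `s > 0` a
point `r_s ∈ [1, ∞)` satisfies `s·h'(r_s) = t`, then `t·r_s − s·h(r_s) → t`
as `s → ∞`. -/
theorem reparam_function_tendsto
    (h : ℝ → ℝ)
    (hconv : ConvexOn ℝ (Set.Ici (1 : ℝ)) h)
    (hdiff : ∀ x ∈ Set.Ici (1 : ℝ), DifferentiableAt ℝ h x)
    (h1 : h 1 = 0)
    (hnonneg : ∀ x ∈ Set.Ici (1 : ℝ), 0 ≤ h x)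
    (hpos : ∀ x : ℝ, 1 < x → 0 < deriv h x)
    (t : ℝ) (ht : 0 < t)
    (r : ℝ → ℝ)
    (hr : ∀ s : ℝ, 0 < s → r s ∈ Set.Ici (1 : ℝ) ∧ s * deriv h (r s) = t) :
    Filter.Tendsto (fun s : ℝ => t * r s - s * h (r s)) Filter.atTop (nhds t) := by
  have hmono : MonotoneOn (deriv h) (Set.Ici 1) := hconv.monotoneOn_deriv hdiff
  have hr_le : ∀ ε : ℝ, 0 < ε → ∀ᶠ s in Filter.atTop, r s < 1 + ε := by
    intro ε hε
    have hd : 0 < deriv h (1 + ε) := hpos _ (by linarith)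
    filter_upwards [Filter.eventually_gt_atTop 0,
      Filter.eventually_gt_atTop (t / deriv h (1 + ε))] with s hs hst
    obtain ⟨hs1, hst'⟩ := hr s hs
    by_contra! hle
    have hd_le := hmono (Set.mem_Ici.2 (by linarith)) hs1 hle
    rw [div_lt_iff₀ hd] at hst
    nlinarith
  have hr_tendsto : Filter.Tendsto r Filter.atTop (nhds 1) := by
    refine tendsto_order.2 ⟨fun a ha => ?_, fun b hb => ?_⟩
    · filter_upwards [Filter.eventually_gt_atTop 0] with s hs
      exact ha.trans_le (hr s hs).1
    · simpa using hr_le (b - 1) (by linarith)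
  have hupper : Filter.Tendsto (fun s => t * r s) Filter.atTop (nhds t) := by
    simpa using hr_tendsto.const_mul t
  refine tendsto_of_tendsto_of_tendsto_of_le_of_le' tendsto_const_nhds hupper ?_ ?_
  · filter_upwards [Filter.eventually_gt_atTop 0] with s hs
    obtain ⟨hs1, hst⟩ := hr s hs
    have tangent : h (r s) ≤ deriv h (r s) * (r s - 1) := by
      rcases eq_or_lt_of_le (Set.mem_Ici.1 hs1) with heq | hlt
      · simp [← heq, h1]
      · have hslope := hconv.slope_le_deriv Set.self_mem_Ici hs1 hlt (hdiff _ hs1)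
        rw [slope_def_field, h1, sub_zero, div_le_iff₀ (sub_pos.2 hlt)] at hslope
        exact hslope
    have hmul := mul_le_mul_of_nonneg_left tangent hs.le
    rw [← mul_assoc, hst] at hmul
    linarith
  · filter_upwards [Filter.eventually_gt_atTop 0] with s hs
    have := mul_nonneg hs.le (hnonneg _ (hr s hs).1)
    linarith
end
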